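/- For a pure bipartite state |ψ⟩_{AB}, the squashed entanglement equals the entropy of entanglement: E_sq(A:B) = S(A), where S(A) is the von Neumann entropy of the reduced state Tr_B |ψ⟩⟨ψ|. -/

import Mathlib

open scoped BigOperators ComplexOrder

noncomputable section

namespace QP

/-- Von Neumann entropy of a (Hermitian) matrix, via its eigenvalues. -/
noncomputable def entropy {n : Type*} [Fintype n] [DecidableEq n] (ρ : Matrix n n ℂ) : ℝ :=
  if h : ρ.IsHermitian then -∑ i, (h.eigenvalues i) * Real.log (h.eigenvalues i) else 0

/-- A density operator: positive semidefinite with unit trace. -/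
def IsState {n : Type*} [Fintype n] (ρ : Matrix n n ℂ) : Prop :=
  ρ.PosSemidef ∧ ρ.trace = 1

variable {A B C D : Type*} [Fintype A] [Fintype B] [Fintype C] [Fintype D]

/-- Partial trace over the second tensor factor. -/
def ptraceR (ρ : Matrix (A × B) (A × B) ℂ) : Matrix A A ℂ :=
  Matrix.of fun a a' => ∑ b, ρ (a, b) (a', b)

/-- Partial trace over the first tensor factor. -/
def ptraceL (ρ : Matrix (A × B) (A × B) ℂ) : Matrix B B ℂ :=
  Matrix.of fun b b' => ∑ a, ρ (a, b) (a, b')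

/-- Reduced state on `A × C` of a tripartite state on `A × B × C`. -/
def redAC (ρ : Matrix (A × B × C) (A × B × C) ℂ) : Matrix (A × C) (A × C) ℂ :=
  Matrix.of fun x y => ∑ b, ρ (x.1, b, x.2) (y.1, b, y.2)

/-- Reduced state on `B × C`. -/
def redBC (ρ : Matrix (A × B × C) (A × B × C) ℂ) : Matrix (B × C) (B × C) ℂ :=
  Matrix.of fun x y => ∑ a, ρ (a, x.1, x.2) (a, y.1, y.2)

/-- Reduced state on `A × B`. -/
def redAB (ρ : Matrix (A × B × C) (A × B × C) ℂ) : Matrix (A × B) (A × B) ℂ :=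
  Matrix.of fun x y => ∑ c, ρ (x.1, x.2, c) (y.1, y.2, c)

/-- Reduced state on `C`. -/
def redC (ρ : Matrix (A × B × C) (A × B × C) ℂ) : Matrix C C ℂ :=
  Matrix.of fun c c' => ∑ a, ∑ b, ρ (a, b, c) (a, b, c')

/-- Quantum conditional mutual information `I(A:B|C)`. -/
noncomputable def cmi [DecidableEq A] [DecidableEq B] [DecidableEq C]
    (ρ : Matrix (A × B × C) (A × B × C) ℂ) : ℝ :=
  entropy (redAC ρ) + entropy (redBC ρ) - entropy ρ - entropy (redC ρ)

/-- Quantum mutual information `I(A:B)`. -/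
noncomputable def mutInfo [DecidableEq A] [DecidableEq B]
    (ρ : Matrix (A × B) (A × B) ℂ) : ℝ :=
  entropy (ptraceR ρ) + entropy (ptraceL ρ) - entropy ρ

/-- Squashed entanglement: infimum of `I(A:B|E')/2` over finite-dimensional extensions. -/
noncomputable def Esq [DecidableEq A] [DecidableEq B] (ρ : Matrix (A × B) (A × B) ℂ) : ℝ :=
  sInf { x : ℝ | ∃ (n : ℕ) (σ : Matrix (A × B × Fin n) (A × B × Fin n) ℂ),
    IsState σ ∧ redAB σ = ρ ∧ x = cmi σ / 2 }

/-- Puffed entanglement: supremum of `I(A:B|E')/2` over finite-dimensional extensions. -/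
noncomputable def Epu [DecidableEq A] [DecidableEq B] (ρ : Matrix (A × B) (A × B) ℂ) : ℝ :=
  sSup { x : ℝ | ∃ (n : ℕ) (σ : Matrix (A × B × Fin n) (A × B × Fin n) ℂ),
    IsState σ ∧ redAB σ = ρ ∧ x = cmi σ / 2 }

/-- Rank-one projector `|ψ⟩⟨ψ|`. -/
def outer {n : Type*} (ψ : n → ℂ) : Matrix n n ℂ :=
  Matrix.of fun x y => ψ x * star (ψ y)

/-- `ψ` is a unit vector. -/
def IsUnitVec {n : Type*} [Fintype n] (ψ : n → ℂ) : Prop :=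
  ∑ x, Complex.normSq (ψ x) = 1

/-- Four-partite reductions (system order `A × B × D × C`, with `D` playing `A'`). -/
def r4AC (ρ : Matrix (A × B × D × C) (A × B × D × C) ℂ) : Matrix (A × C) (A × C) ℂ :=
  Matrix.of fun x y => ∑ b, ∑ d, ρ (x.1, b, d, x.2) (y.1, b, d, y.2)

def r4BC (ρ : Matrix (A × B × D × C) (A × B × D × C) ℂ) : Matrix (B × C) (B × C) ℂ :=
  Matrix.of fun x y => ∑ a, ∑ d, ρ (a, x.1, d, x.2) (a, y.1, d, y.2)

def r4ABC (ρ : Matrix (A × B × D × C) (A × B × D × C) ℂ) : Matrix (A × B × C) (A × B × C) ℂ :=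
  Matrix.of fun x y => ∑ d, ρ (x.1, x.2.1, d, x.2.2) (y.1, y.2.1, d, y.2.2)

def r4C (ρ : Matrix (A × B × D × C) (A × B × D × C) ℂ) : Matrix C C ℂ :=
  Matrix.of fun c c' => ∑ a, ∑ b, ∑ d, ρ (a, b, d, c) (a, b, d, c')

def r4A (ρ : Matrix (A × B × D × C) (A × B × D × C) ℂ) : Matrix A A ℂ :=
  Matrix.of fun a a' => ∑ b, ∑ d, ∑ c, ρ (a, b, d, c) (a', b, d, c)

def r4D (ρ : Matrix (A × B × D × C) (A × B × D × C) ℂ) : Matrix D D ℂ :=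
  Matrix.of fun d d' => ∑ a, ∑ b, ∑ c, ρ (a, b, d, c) (a, b, d', c)

def r4AD (ρ : Matrix (A × B × D × C) (A × B × D × C) ℂ) : Matrix (A × D) (A × D) ℂ :=
  Matrix.of fun x y => ∑ b, ∑ c, ρ (x.1, b, x.2, c) (y.1, b, y.2, c)

def r4DC (ρ : Matrix (A × B × D × C) (A × B × D × C) ℂ) : Matrix (D × C) (D × C) ℂ :=
  Matrix.of fun x y => ∑ a, ∑ b, ρ (a, b, x.1, x.2) (a, b, y.1, y.2)

/-- `I(A:B|C)` for a four-partite state on `A × B × D × C`, conditioning on the last factor. -/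
noncomputable def cmi4 [DecidableEq A] [DecidableEq B] [DecidableEq C] [DecidableEq D]
    (ρ : Matrix (A × B × D × C) (A × B × D × C) ℂ) : ℝ :=
  entropy (r4AC ρ) + entropy (r4BC ρ) - entropy (r4ABC ρ) - entropy (r4C ρ)

end QP

open QP

namespace QP

open Matrix Polynomial Kronecker

theorem isHermitian_kronecker {m n : Type*} {ρ : Matrix m m ℂ} {σ : Matrix n n ℂ}
    (hρ : ρ.IsHermitian) (hσ : σ.IsHermitian) : (ρ ⊗ₖ σ).IsHermitian := by
  rw [IsHermitian, conjTranspose_kronecker, hρ.eq, hσ.eq]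

section Entropy

variable {m n : Type*} [Fintype m] [Fintype n] [DecidableEq m] [DecidableEq n]

theorem entropy_eq_sum_negMulLog {ρ : Matrix n n ℂ} (h : ρ.IsHermitian) :
    entropy ρ = ∑ i, Real.negMulLog (h.eigenvalues i) := by
  simp [entropy, h, Real.negMulLog]

theorem entropy_eq_sum_roots {ρ : Matrix n n ℂ} (h : ρ.IsHermitian) :
    entropy ρ = (ρ.charpoly.roots.map fun z => Real.negMulLog z.re).sum := by
  rw [entropy_eq_sum_negMulLog h, h.roots_charpoly_eq_eigenvalues, Multiset.map_map]
  simp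

theorem entropy_eq_of_charpoly_eq {ρ : Matrix m m ℂ} {σ : Matrix n n ℂ} (hρ : ρ.IsHermitian)
    (hσ : σ.IsHermitian) (h : ρ.charpoly = σ.charpoly) : entropy ρ = entropy σ := by
  rw [entropy_eq_sum_roots hρ, entropy_eq_sum_roots hσ, h]

theorem entropy_transpose {ρ : Matrix n n ℂ} (h : ρ.IsHermitian) : entropy ρᵀ = entropy ρ :=
  entropy_eq_of_charpoly_eq h.transpose h (charpoly_transpose ρ)

theorem entropy_reindex (e : m ≃ n) {ρ : Matrix m m ℂ} (h : ρ.IsHermitian) :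
    entropy (reindex e e ρ) = entropy ρ :=
  entropy_eq_of_charpoly_eq (h.submatrix _) h (charpoly_reindex e ρ)

theorem entropy_diagonal (d : n → ℝ) :
    entropy (diagonal fun i => (d i : ℂ)) = ∑ i, Real.negMulLog (d i) := by
  rw [entropy_eq_sum_roots (by simp [IsHermitian, diagonal_conjTranspose, Pi.star_def]),
    charpoly_diagonal, roots_prod _ _ (Finset.prod_ne_zero_iff.mpr fun i _ => X_sub_C_ne_zero _)]
  simp

/-- The nonzero spectra of `M * N` and `N * M` agree. -/
theorem entropy_mul_comm {M : Matrix m n ℂ} {N : Matrix n m ℂ} (h₁ : (M * N).IsHermitian)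
    (h₂ : (N * M).IsHermitian) : entropy (M * N) = entropy (N * M) := by
  have h := congrArg (fun p : ℂ[X] => (p.roots.map fun z => Real.negMulLog z.re).sum)
    (charpoly_mul_comm' M N)
  have hX (k : ℕ) {p : ℂ[X]} (hp : p.Monic) :
      ((X ^ k * p).roots.map fun z : ℂ => Real.negMulLog z.re).sum
        = (p.roots.map fun z : ℂ => Real.negMulLog z.re).sum := by
    rw [roots_mul (mul_ne_zero (pow_ne_zero _ X_ne_zero) hp.ne_zero)]
    simp [Multiset.map_nsmul, Multiset.sum_nsmul]
  simpa only [hX _ (charpoly_monic (M * N)), hX _ (charpoly_monic (N * M)),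
    ← entropy_eq_sum_roots h₁, ← entropy_eq_sum_roots h₂]
    using h

theorem sum_eigenvalues_eq_one {ρ : Matrix n n ℂ} (h : ρ.IsHermitian) (ht : ρ.trace = 1) :
    ∑ i, h.eigenvalues i = 1 := by
  rw [h.trace_eq_sum_eigenvalues] at ht
  exact Complex.ofReal_injective (by simpa using ht)

theorem charpoly_kronecker {ρ : Matrix m m ℂ} {σ : Matrix n n ℂ} (hρ : ρ.IsHermitian)
    (hσ : σ.IsHermitian) :
    (ρ ⊗ₖ σ).charpoly
      = (diagonal fun x : m × n =>
          ((hρ.eigenvalues x.1 * hσ.eigenvalues x.2 : ℝ) : ℂ)).charpoly := by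
  conv_lhs => rw [hρ.spectral_theorem, hσ.spectral_theorem]
  rw [Unitary.conjStarAlgAut_apply, Unitary.conjStarAlgAut_apply, mul_kronecker_mul,
    charpoly_mul_comm, mul_kronecker_mul, ← mul_assoc, ← mul_kronecker_mul]
  simp [diagonal_kronecker_diagonal]

/-- The von Neumann entropy is additive on tensor products. -/
theorem entropy_kronecker {ρ : Matrix m m ℂ} {σ : Matrix n n ℂ} (hρ : ρ.IsHermitian)
    (hσ : σ.IsHermitian) (hρt : ρ.trace = 1) (hσt : σ.trace = 1) :
    entropy (ρ ⊗ₖ σ) = entropy ρ + entropy σ := by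
  have hd : (diagonal fun x : m × n =>
      ((hρ.eigenvalues x.1 * hσ.eigenvalues x.2 : ℝ) : ℂ)).IsHermitian := by
    simp [IsHermitian, diagonal_conjTranspose, Pi.star_def]
  rw [entropy_eq_of_charpoly_eq (isHermitian_kronecker hρ hσ) hd (charpoly_kronecker hρ hσ),
    entropy_diagonal, Fintype.sum_prod_type, entropy_eq_sum_negMulLog hρ,
    entropy_eq_sum_negMulLog hσ]
  simp only [Real.negMulLog_mul, Finset.sum_add_distrib, ← Finset.mul_sum, ← Finset.sum_mul,
    sum_eigenvalues_eq_one hρ hρt, sum_eigenvalues_eq_one hσ hσt, one_mul]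

end Entropy

section Pure

variable {A B X C : Type*} [Fintype A] [Fintype B] [Fintype X] [Fintype C]

theorem outer_isHermitian {n : Type*} (ψ : n → ℂ) : (outer ψ).IsHermitian := by
  ext x y
  simp [outer, mul_comm]

theorem sum_mul_star_of_isUnitVec {ψ : X → ℂ} (h : IsUnitVec ψ) : ∑ x, ψ x * star (ψ x) = 1 := by
  simp only [Complex.star_def, Complex.mul_conj]
  exact_mod_cast h

theorem trace_outer {ψ : X → ℂ} (h : IsUnitVec ψ) : (outer ψ).trace = 1 :=
  sum_mul_star_of_isUnitVec h

theorem outer_mul_self {ψ : X → ℂ} (h : IsUnitVec ψ) : outer ψ * outer ψ = outer ψ := by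
  ext x y
  calc ∑ z, ψ x * star (ψ z) * (ψ z * star (ψ y))
      = ψ x * star (ψ y) * ∑ z, ψ z * star (ψ z) := by
        rw [Finset.mul_sum]; exact Finset.sum_congr rfl fun _ _ => by ring
    _ = ψ x * star (ψ y) := by rw [sum_mul_star_of_isUnitVec h, mul_one]

theorem ptraceR_isHermitian {A B : Type*} [Fintype B] {ρ : Matrix (A × B) (A × B) ℂ}
    (h : ρ.IsHermitian) :
    (ptraceR ρ).IsHermitian := by
  ext x y
  simp only [ptraceR, conjTranspose_apply, of_apply, star_sum, h.apply]

theorem ptraceL_isHermitian {A B : Type*} [Fintype A] {ρ : Matrix (A × B) (A × B) ℂ}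
    (h : ρ.IsHermitian) :
    (ptraceL ρ).IsHermitian := by
  ext x y
  simp only [ptraceL, conjTranspose_apply, of_apply, star_sum, h.apply]

theorem trace_ptraceR (ρ : Matrix (A × B) (A × B) ℂ) : (ptraceR ρ).trace = ρ.trace := by
  simp [ptraceR, trace, Fintype.sum_prod_type]

theorem trace_ptraceL (ρ : Matrix (A × B) (A × B) ℂ) : (ptraceL ρ).trace = ρ.trace := by
  simp [ptraceL, trace, Fintype.sum_prod_type_right]

/-- The two marginals of a pure state have the same entropy. -/
theorem entropy_ptraceL_outer [DecidableEq A] [DecidableEq B] (ψ : A × B → ℂ) :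
    entropy (ptraceL (outer ψ)) = entropy (ptraceR (outer ψ)) := by
  let M : Matrix A B ℂ := of fun a b => ψ (a, b)
  have hR : ptraceR (outer ψ) = M * Mᴴ := by
    ext a a'; simp [ptraceR, outer, M, mul_apply]
  have hL : ptraceL (outer ψ) = (Mᴴ * M)ᵀ := by
    ext b b'; simp [ptraceL, outer, M, mul_apply, mul_comm]
  rw [hR, hL, entropy_transpose (isHermitian_conjTranspose_mul_self M),
    entropy_mul_comm (isHermitian_conjTranspose_mul_self M) (isHermitian_mul_conjTranspose_self M)]

theorem entropy_outer [DecidableEq X] {ψ : X → ℂ} (h : IsUnitVec ψ) : entropy (outer ψ) = 0 := by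
  let M : Matrix X Unit ℂ := of fun x _ => ψ x
  have h₁ : outer ψ = M * Mᴴ := by
    ext x y; simp [outer, M, mul_apply]
  have h₂ : Mᴴ * M = diagonal fun _ => ((1 : ℝ) : ℂ) := by
    ext x y
    simpa [M, mul_apply, mul_comm] using sum_mul_star_of_isUnitVec h
  rw [h₁, entropy_mul_comm (isHermitian_mul_conjTranspose_self M)
    (isHermitian_conjTranspose_mul_self M), h₂, entropy_diagonal]
  simp

/-- Every extension of a pure state is a product. -/
theorem eq_kronecker_of_ptraceR_eq_outer {σ : Matrix (X × C) (X × C) ℂ} (hσ : σ.PosSemidef)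
    {ψ : X → ℂ} (hψ : IsUnitVec ψ) (h : ptraceR σ = outer ψ) :
    σ = outer ψ ⊗ₖ ptraceL σ := by
  classical
  obtain ⟨k, v, rfl⟩ := posSemidef_iff_eq_sum_vecMulVec.mp hσ
  let W : Matrix X (C × Fin k) ℂ := of fun x j => v j.2 (x, j.1)
  have hW : W * Wᴴ = outer ψ := by
    rw [← h]
    ext x y
    simp [W, ptraceR, mul_apply, Fintype.sum_prod_type, Matrix.sum_apply, vecMulVec_apply]
  have hPW : outer ψ * W = W := by
    have h0 : (W - outer ψ * W) * (W - outer ψ * W)ᴴ = 0 := by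
      rw [conjTranspose_sub, conjTranspose_mul, (outer_isHermitian ψ).eq, Matrix.sub_mul,
        Matrix.mul_sub, Matrix.mul_sub, ← Matrix.mul_assoc W, hW, Matrix.mul_assoc _ W, hW,
        Matrix.mul_assoc _ W, ← Matrix.mul_assoc W, hW]
      simp [outer_mul_self hψ]
    exact (sub_eq_zero.mp (self_mul_conjTranspose_eq_zero.mp h0)).symm
  have hv (i : Fin k) (x : X) (c : C) : v i (x, c) = ψ x * ∑ z, star (ψ z) * v i (z, c) := by
    have := congrFun (congrFun hPW x) (c, i)
    simpa [W, outer, mul_apply, Finset.mul_sum, mul_assoc] using this.symm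
  obtain ⟨g, hg⟩ : ∃ g : Fin k → C → ℂ, ∀ i x c, v i (x, c) = ψ x * g i c := ⟨_, hv⟩
  ext ⟨x, c⟩ ⟨y, c'⟩
  have hL : ptraceL (∑ i, vecMulVec (v i) (star (v i))) c c' = ∑ i, g i c * star (g i c') := by
    simp only [ptraceL, of_apply, Matrix.sum_apply, vecMulVec_apply, Pi.star_apply, hg, star_mul']
    rw [Finset.sum_comm]
    refine Finset.sum_congr rfl fun i _ => ?_
    rw [← one_mul (g i c * _), ← sum_mul_star_of_isUnitVec hψ, Finset.sum_mul]
    exact Finset.sum_congr rfl fun _ _ => by ring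
  rw [kroneckerMap_apply, hL]
  simp only [Matrix.sum_apply, vecMulVec_apply, Pi.star_apply, hg, star_mul', outer, of_apply,
    Finset.mul_sum]
  exact Finset.sum_congr rfl fun _ _ => by ring

/-- The conditional mutual information of a product `ρ_{AB} ⊗ ρ_C` is `I(A:B)`. -/
theorem cmi_reindex_kronecker [DecidableEq A] [DecidableEq B] [DecidableEq C]
    {ρ : Matrix (A × B) (A × B) ℂ} {τ : Matrix C C ℂ} (hρ : ρ.IsHermitian) (hτ : τ.IsHermitian)
    (hρt : ρ.trace = 1) (hτt : τ.trace = 1) :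
    cmi (reindex (Equiv.prodAssoc A B C) (Equiv.prodAssoc A B C) (ρ ⊗ₖ τ)) = mutInfo ρ := by
  set σ := reindex (Equiv.prodAssoc A B C) (Equiv.prodAssoc A B C) (ρ ⊗ₖ τ) with hσ
  have hAC : redAC σ = ptraceR ρ ⊗ₖ τ := by
    ext x y
    simp [redAC, ptraceR, hσ, Finset.sum_mul]
  have hBC : redBC σ = ptraceL ρ ⊗ₖ τ := by
    ext x y
    simp [redBC, ptraceL, hσ, Finset.sum_mul]
  have hC : redC σ = τ := by
    ext x y
    have : ∑ a, ∑ b, ρ (a, b) (a, b) = 1 := by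
      rw [← hρt, trace, Fintype.sum_prod_type]; rfl
    simp [redC, hσ, ← Finset.sum_mul, this]
  rw [cmi, mutInfo, hAC, hBC, hC, hσ, entropy_reindex _ (isHermitian_kronecker hρ hτ),
    entropy_kronecker hρ hτ hρt hτt,
    entropy_kronecker (ptraceR_isHermitian hρ) hτ ((trace_ptraceR ρ).trans hρt) hτt,
    entropy_kronecker (ptraceL_isHermitian hρ) hτ ((trace_ptraceL ρ).trans hρt) hτt]
  ring

theorem mutInfo_outer [DecidableEq A] [DecidableEq B] {ψ : A × B → ℂ} (hψ : IsUnitVec ψ) :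
    mutInfo (outer ψ) = 2 * entropy (ptraceR (outer ψ)) := by
  rw [mutInfo, entropy_ptraceL_outer, entropy_outer hψ]
  ring

theorem outer_posSemidef {n : Type*} [Fintype n] (ψ : n → ℂ) : (outer ψ).PosSemidef :=
  posSemidef_vecMulVec_self_star ψ

/-- Every extension of a pure state has conditional mutual information `2 S(A)`. -/
theorem cmi_eq_of_redAB_eq_outer [DecidableEq A] [DecidableEq B] [DecidableEq C]
    {ψ : A × B → ℂ} (hψ : IsUnitVec ψ) {σ : Matrix (A × B × C) (A × B × C) ℂ} (hσ : IsState σ)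
    (h : redAB σ = outer ψ) : cmi σ = 2 * entropy (ptraceR (outer ψ)) := by
  let e := Equiv.prodAssoc A B C
  let σ' := reindex e.symm e.symm σ
  have hσ' : σ'.PosSemidef := hσ.1.submatrix e
  have hprod : σ' = outer ψ ⊗ₖ ptraceL σ' := eq_kronecker_of_ptraceR_eq_outer hσ' hψ h
  have ht : (ptraceL σ').trace = 1 := by
    rw [trace_ptraceL, ← hσ.2]
    exact Equiv.sum_comp e fun x => σ x x
  have hσe : σ = reindex e e (outer ψ ⊗ₖ ptraceL σ') := by
    rw [← hprod]
    ext x y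
    simp [σ']
  rw [hσe, cmi_reindex_kronecker (outer_isHermitian ψ) (ptraceL_isHermitian hσ'.1)
    (trace_outer hψ) ht, mutInfo_outer hψ]

theorem exists_extension_outer {ψ : A × B → ℂ} (hψ : IsUnitVec ψ) :
    ∃ σ : Matrix (A × B × Fin 1) (A × B × Fin 1) ℂ, IsState σ ∧ redAB σ = outer ψ := by
  refine ⟨outer fun x => ψ (x.1, x.2.1), ⟨outer_posSemidef _, trace_outer ?_⟩, ?_⟩
  · simpa [IsUnitVec, Fintype.sum_prod_type] using hψ
  · ext x y
    simp [redAB, outer]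

end Pure

end QP

/-- for a pure bipartite state, `E_sq(A:B) = S(A)`. -/
theorem Esq_of_pure {A B : Type*} [Fintype A] [Fintype B] [DecidableEq A] [DecidableEq B]
    (ψ : A × B → ℂ) (hψ : IsUnitVec ψ) :
    Esq (outer ψ) = entropy (ptraceR (outer ψ)) := by
  have hset : { x : ℝ | ∃ (n : ℕ) (σ : Matrix (A × B × Fin n) (A × B × Fin n) ℂ),
      IsState σ ∧ redAB σ = outer ψ ∧ x = cmi σ / 2 } = {entropy (ptraceR (outer ψ))} := by
    ext x
    constructor
    · rintro ⟨n, σ, hσ, h, rfl⟩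
      simp [cmi_eq_of_redAB_eq_outer hψ hσ h]
    · rintro rfl
      obtain ⟨σ, hσ, h⟩ := exists_extension_outer hψ
      exact ⟨1, σ, hσ, h, by simp [cmi_eq_of_redAB_eq_outer hψ hσ h]⟩
  rw [Esq, hset, csInf_singleton]
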